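/- If H is a hypergraph with graph part G, then dim H = dim cl(G) = 1, where cl(G) is the closure of G in ℝ² and dim denotes topological (covering) dimension. -/

import Mathlib

open Set Filter Topology

/-- `DimLE X n` : the topological (covering) dimension of `X` is at most `n`. -/
def DimLE (X : Type*) [TopologicalSpace X] (n : ℕ) : Prop :=
  ∀ (k : ℕ) (U : Fin k → Set X), (∀ i, IsOpen (U i)) → (⋃ i, U i) = Set.univ →
    ∃ V : Fin k → Set X, (∀ i, IsOpen (V i)) ∧ (∀ i, V i ⊆ U i) ∧ (⋃ i, V i) = Set.univ ∧
      ∀ x : X, ({i | x ∈ V i}).ncard ≤ n + 1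

/-- `clusterVals f P a` : the set of cluster values of `f` (restricted to `P`) at `a`,
i.e. the limits of sequences `f xⱼ` with `xⱼ ∈ P`, `xⱼ → a`. -/
def clusterVals (f : ℝ → ℝ) (P : Set ℝ) (a : ℝ) : Set ℝ :=
  {y | MapClusterPt y (nhdsWithin a P) f}

/-- `H` is a hypergraph witnessed by the interval `I`, the countable set `Q ⊆ I` and the
function `f` continuous on `P = I ∖ Q` : `G ⊆ H ⊆ cl G` where `G = graph of f on P`;
at every `a ∈ Q` the cluster-value set of `f` equals both the left and the right
cluster-value sets and is a nontrivial interval; `f` differs from a function continuous on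
`I ∖ {a}` by a function having a limit at `a`; and every vertical section `H(a)`, `a ∈ Q`,
is dense in and has empty interior in `Ωf(a) = cl(G)(a)`. -/
def IsHypergraphWith (H : Set (ℝ × ℝ)) (I Q : Set ℝ) (f : ℝ → ℝ) : Prop :=
  I.OrdConnected ∧ (∃ a ∈ I, ∃ b ∈ I, a < b) ∧ Q ⊆ I ∧ Q.Countable ∧
  ContinuousOn f (I \ Q) ∧
  Set.graphOn f (I \ Q) ⊆ H ∧ H ⊆ closure (Set.graphOn f (I \ Q)) ∧
  ∀ a ∈ Q,
    (clusterVals f (I \ Q) a = clusterVals f ((I \ Q) ∩ Set.Iic a) a ∧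
     clusterVals f (I \ Q) a = clusterVals f ((I \ Q) ∩ Set.Ici a) a ∧
     (clusterVals f (I \ Q) a).OrdConnected ∧
     (∃ y ∈ clusterVals f (I \ Q) a, ∃ z ∈ clusterVals f (I \ Q) a, y < z)) ∧
    (∃ g : ℝ → ℝ, ContinuousOn g (I \ {a}) ∧
      ∃ L : ℝ, Filter.Tendsto (fun x => f x - g x) (nhdsWithin a (I \ Q)) (nhds L)) ∧
    (∀ y ∈ clusterVals f (I \ Q) a, y ∈ closure {y' : ℝ | (a, y') ∈ H}) ∧
    (∀ U : Set ℝ, IsOpen U → (U ∩ clusterVals f (I \ Q) a).Nonempty →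
      ¬ (U ∩ clusterVals f (I \ Q) a ⊆ {y' : ℝ | (a, y') ∈ H}))

/-- `H ⊆ ℝ²` is a hypergraph. -/
def IsHypergraph (H : Set (ℝ × ℝ)) : Prop := ∃ I Q f, IsHypergraphWith H I Q f

/-- A set whose points have arbitrarily small open neighbourhoods with boundary missing the set
is zero-dimensional: its open covers have pairwise disjoint open shrinkings. -/
theorem exists_disjoint_shrinking {α ι : Type*} [TopologicalSpace α] [SecondCountableTopology α]
    {A : Set α}
    (hA : ∀ p ∈ A, ∀ U : Set α, IsOpen U → p ∈ U →
      ∃ W : Set α, IsOpen W ∧ p ∈ W ∧ W ⊆ U ∧ Disjoint (frontier W) A)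
    (U : ι → Set α) (hU : ∀ i, IsOpen (U i)) (hAU : A ⊆ ⋃ i, U i) :
    ∃ V : ι → Set α, (∀ i, IsOpen (V i)) ∧ (∀ i, V i ⊆ U i) ∧ A ⊆ ⋃ i, V i ∧
      ∀ x i j, x ∈ V i → x ∈ V j → i = j := by
  rcases A.eq_empty_or_nonempty with rfl | hne
  · exact ⟨fun _ => ∅, fun _ => isOpen_empty, fun _ => empty_subset _, empty_subset _,
      fun _ _ _ h => h.elim⟩
  have hcov : ∀ p : A, ∃ i, (p : α) ∈ U i := fun p => mem_iUnion.1 (hAU p.2)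
  choose c hc using hcov
  choose W hWo hpW hWU hWA using fun p : A => hA p p.2 (U (c p)) (hU _) (hc p)
  obtain ⟨T, hT, hTW⟩ := TopologicalSpace.isOpen_iUnion_countable W hWo
  have hAT : ∀ p ∈ A, ∃ q ∈ T, p ∈ W q := by
    intro p hp
    have : p ∈ ⋃ q ∈ T, W q := by
      rw [hTW]
      exact mem_iUnion.2 ⟨⟨p, hp⟩, hpW ⟨p, hp⟩⟩
    simpa only [mem_iUnion, exists_prop] using this
  have hTne : T.Nonempty := by
    obtain ⟨p, hp⟩ := hne
    obtain ⟨q, hq, -⟩ := hAT p hp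
    exact ⟨q, hq⟩
  obtain ⟨e, rfl⟩ := hT.exists_eq_range hTne
  let W' : ℕ → Set α := fun n => W (e n) \ closure (⋃ m ∈ Iio n, W (e m))
  have hW'o : ∀ n, IsOpen (W' n) := fun n => (hWo _).sdiff isClosed_closure
  have hdisj : ∀ m n x, m < n → x ∈ W' m → x ∈ W' n → False := fun m n x hmn hm hn =>
    hn.2 (subset_closure (mem_biUnion (mem_Iio.2 hmn) hm.1))
  refine ⟨fun i => ⋃ n ∈ {n | c (e n) = i}, W' n, fun i => isOpen_biUnion fun n _ => hW'o n,
    fun i => iUnion₂_subset ?_, ?_, ?_⟩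
  · rintro n rfl
    exact sdiff_subset.trans (hWU _)
  · intro p hp
    have hex : ∃ n, p ∈ W (e n) := by
      obtain ⟨_, ⟨n, rfl⟩, h⟩ := hAT p hp
      exact ⟨n, h⟩
    classical
    refine mem_iUnion.2 ⟨c (e (Nat.find hex)), mem_biUnion (x := Nat.find hex) rfl
      ⟨Nat.find_spec hex, fun hcl => ?_⟩⟩
    rw [(finite_Iio _).closure_biUnion] at hcl
    obtain ⟨m, hm, hpm⟩ := mem_iUnion₂.1 hcl
    refine disjoint_left.1 (hWA (e m)) ?_ hp
    rw [(hWo _).frontier_eq]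
    exact ⟨hpm, Nat.find_min hex hm⟩
  · intro x i j hi hj
    obtain ⟨m, rfl, hm⟩ := mem_iUnion₂.1 hi
    obtain ⟨n, rfl, hn⟩ := mem_iUnion₂.1 hj
    rcases lt_trichotomy m n with h | h | h
    · exact (hdisj _ _ _ h hm hn).elim
    · rw [h]
    · exact (hdisj _ _ _ h hn hm).elim

/-- A union of two zero-dimensional sets has dimension at most one. -/
theorem dimLE_one_of_subset_union {α : Type*} [TopologicalSpace α] [SecondCountableTopology α]
    {A B K : Set α} (hK : K ⊆ A ∪ B)
    (hA : ∀ p ∈ A, ∀ U : Set α, IsOpen U → p ∈ U →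
      ∃ W : Set α, IsOpen W ∧ p ∈ W ∧ W ⊆ U ∧ Disjoint (frontier W) A)
    (hB : ∀ p ∈ B, ∀ U : Set α, IsOpen U → p ∈ U →
      ∃ W : Set α, IsOpen W ∧ p ∈ W ∧ W ⊆ U ∧ Disjoint (frontier W) B) :
    DimLE K 1 := by
  intro k U hU hcov
  choose O hO hOU using fun i => isOpen_induced_iff.1 (hU i)
  have hKO : K ⊆ ⋃ i, O i := by
    intro p hp
    have : (⟨p, hp⟩ : K) ∈ ⋃ i, U i := hcov ▸ mem_univ _
    obtain ⟨i, hi⟩ := mem_iUnion.1 this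
    rw [← hOU i] at hi
    exact mem_iUnion.2 ⟨i, hi⟩
  have key : ∀ C : Set α, (∀ p ∈ C, ∀ U : Set α, IsOpen U → p ∈ U →
      ∃ W : Set α, IsOpen W ∧ p ∈ W ∧ W ⊆ U ∧ Disjoint (frontier W) C) →
      ∃ V : Fin k → Set α, (∀ i, IsOpen (V i)) ∧ (∀ i, V i ⊆ O i) ∧ C ∩ K ⊆ ⋃ i, V i ∧
        ∀ x i j, x ∈ V i → x ∈ V j → i = j := by
    intro C hC
    refine exists_disjoint_shrinking (fun p hp U hU hpU => ?_) O hO (inter_subset_right.trans hKO)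
    obtain ⟨W, h1, h2, h3, h4⟩ := hC p hp.1 U hU hpU
    exact ⟨W, h1, h2, h3, h4.mono_right inter_subset_left⟩
  obtain ⟨V, hVo, hVO, hVc, hVd⟩ := key A hA
  obtain ⟨V', hVo', hVO', hVc', hVd'⟩ := key B hB
  refine ⟨fun i => (↑) ⁻¹' (V i ∪ V' i),
    fun i => ((hVo i).union (hVo' i)).preimage continuous_subtype_val, fun i => ?_, ?_, ?_⟩
  · rw [← hOU i]
    exact preimage_mono (union_subset (hVO i) (hVO' i))
  · refine eq_univ_of_forall fun p => mem_iUnion.2 ?_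
    rcases hK p.2 with h | h
    · obtain ⟨i, hi⟩ := mem_iUnion.1 (hVc ⟨h, p.2⟩)
      exact ⟨i, Or.inl hi⟩
    · obtain ⟨i, hi⟩ := mem_iUnion.1 (hVc' ⟨h, p.2⟩)
      exact ⟨i, Or.inr hi⟩
  · intro x
    have h1 : {i | (x : α) ∈ V i}.ncard ≤ 1 :=
      (ncard_le_one (toFinite _)).2 fun i hi j hj => hVd _ _ _ hi hj
    have h2 : {i | (x : α) ∈ V' i}.ncard ≤ 1 :=
      (ncard_le_one (toFinite _)).2 fun i hi j hj => hVd' _ _ _ hi hj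
    exact (ncard_union_le {i | (x : α) ∈ V i} {i | (x : α) ∈ V' i}).trans (add_le_add h1 h2)

/-- Points of the plane have small rectangular neighbourhoods with sides on the lines
`x ∈ D` and `y ∈ E`. -/
theorem exists_rectangle_frontier_disjoint {A : Set (ℝ × ℝ)} {D E : Set ℝ} (hD : Dense D)
    (hE : Dense E) (hA : ∀ p ∈ A, p.1 ∉ D ∧ p.2 ∉ E) (p : ℝ × ℝ) (U : Set (ℝ × ℝ))
    (hU : IsOpen U) (hp : p ∈ U) :
    ∃ W : Set (ℝ × ℝ), IsOpen W ∧ p ∈ W ∧ W ⊆ U ∧ Disjoint (frontier W) A := by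
  have side : ∀ {T : Set ℝ}, Dense T → ∀ {N : Set ℝ} {x : ℝ}, N ∈ 𝓝 x →
      ∃ a ∈ T, ∃ b ∈ T, x ∈ Ioo a b ∧ Ioo a b ⊆ N := by
    intro T hT N x hN
    obtain ⟨l, u, hx, hlu⟩ := mem_nhds_iff_exists_Ioo_subset.1 hN
    obtain ⟨a, ha, hla⟩ := hT.exists_between hx.1
    obtain ⟨b, hb, hbu⟩ := hT.exists_between hx.2
    exact ⟨a, ha, b, hb, ⟨hla.2, hbu.1⟩, (Ioo_subset_Ioo hla.1.le hbu.2.le).trans hlu⟩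
  obtain ⟨M, hM, N, hN, hMN⟩ := mem_nhds_prod_iff.1 (hU.mem_nhds hp)
  obtain ⟨a, ha, b, hb, hab, habM⟩ := side hD hM
  obtain ⟨c, hc, d, hd, hcd, hcdN⟩ := side hE hN
  refine ⟨Ioo a b ×ˢ Ioo c d, isOpen_Ioo.prod isOpen_Ioo, ⟨hab, hcd⟩,
    (prod_mono habM hcdN).trans hMN, disjoint_left.2 ?_⟩
  rintro ⟨x, y⟩ hxy hxyA
  rw [frontier_prod_eq, frontier_Ioo (hab.1.trans hab.2), frontier_Ioo (hcd.1.trans hcd.2)] at hxy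
  obtain ⟨hxD, hyE⟩ := hA _ hxyA
  rcases hxy with ⟨-, rfl | rfl⟩ | ⟨rfl | rfl, -⟩
  exacts [hyE hc, hyE hd, hxD ha, hxD hb]

/-- A subset of the plane all but countably many of whose vertical sections have at most one
point has dimension at most one. -/
theorem dimLE_one_of_countable_sections {K : Set (ℝ × ℝ)} {f : ℝ → ℝ} {R : Set ℝ}
    (hR : R.Countable) (hK : ∀ p ∈ K, p.1 ∉ R → p.2 = f p.1) : DimLE K 1 := by
  obtain ⟨D, hDR, hDc, hD⟩ := (hR.dense_compl ℝ).exists_countable_dense_subset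
  obtain ⟨S, hSR, hSc, hS⟩ := ((hR.union hDc).dense_compl ℝ).exists_countable_dense_subset
  obtain ⟨E, hES, hEc, hE⟩ := ((hSc.image f).dense_compl ℝ).exists_countable_dense_subset
  refine dimLE_one_of_subset_union (A := {p | p ∈ K ∧ (p.1 ∈ D ∨ p.2 ∈ E)})
    (B := {p | p.1 ∉ D ∧ p.2 ∉ E}) (fun p hp => ?_)
    (fun p _ => exists_rectangle_frontier_disjoint hS
      ((hEc.union (hDc.image f)).dense_compl ℝ) ?_ p)
    (fun p _ => exists_rectangle_frontier_disjoint hD hE (fun _ h => h) p)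
  · by_cases h : p.1 ∈ D ∨ p.2 ∈ E
    · exact Or.inl ⟨hp, h⟩
    · exact Or.inr (not_or.1 h)
  · rintro ⟨x, y⟩ ⟨hxy, h⟩
    refine ⟨fun hx => ?_, fun hy => ?_⟩
    · have hx' := hSR hx
      have hyf : y = f x := hK _ hxy fun h => hx' (Or.inl h)
      rcases h with h | h
      · exact hx' (Or.inr h)
      · exact hES h ⟨x, hx, hyf.symm⟩
    · rcases h with h | h
      · exact hy (Or.inr ⟨x, h, (hK _ hxy (hDR h)).symm⟩)
      · exact hy (Or.inl h)

/-- An interval of the line is closed up to two points. -/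
theorem finite_closure_diff_of_ordConnected {I : Set ℝ} (hI : I.OrdConnected) :
    (closure I \ I).Finite := by
  refine (toFinite {sInf I, sSup I}).subset ?_
  rintro x ⟨hx, hxI⟩
  have hne : I.Nonempty := closure_nonempty_iff.1 ⟨x, hx⟩
  by_cases h : ∃ u ∈ I, u ≤ x
  · obtain ⟨u, hu, hux⟩ := h
    have hub : x ∈ upperBounds I := fun v hv =>
      le_of_not_ge fun hxv => hxI (hI.out hu hv ⟨hux, hxv⟩)
    exact Or.inr (isLUB_of_mem_closure hub hx |>.csSup_eq hne).symm
  · have hlb : x ∈ lowerBounds I := fun v hv => le_of_not_ge fun hvx => h ⟨v, hv, hvx⟩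
    exact Or.inl (isGLB_of_mem_closure hlb hx |>.csInf_eq hne).symm

theorem isLocallyClosed_of_ordConnected {I : Set ℝ} (hI : I.OrdConnected) :
    IsLocallyClosed I := by
  have h := (isClosed_closure (s := I)).isLocallyClosed.inter
    (finite_closure_diff_of_ordConnected hI).isClosed.isOpen_compl.isLocallyClosed
  convert h using 1
  ext x
  simp only [mem_inter_iff, mem_compl_iff, Set.mem_sdiff, not_and, not_not]
  exact ⟨fun hx => ⟨subset_closure hx, fun _ => hx⟩, fun hx => hx.2 hx.1⟩

/-- A nonempty countable locally closed set of reals has an isolated point. -/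
theorem exists_isolated_of_isLocallyClosed {F : Set ℝ} (hF : IsLocallyClosed F)
    (hc : F.Countable) (hne : F.Nonempty) :
    ∃ a ∈ F, ∃ l u, a ∈ Ioo l u ∧ Ioo l u ∩ F ⊆ {a} := by
  have := hF.locallyCompactSpace
  have := hne.to_subtype
  have := hc.to_subtype
  obtain ⟨a, x, hx⟩ := nonempty_interior_of_iUnion_of_closed (X := F) (f := fun a : F => {a})
    (fun _ => isClosed_singleton) (iUnion_of_singleton F)
  obtain rfl : x = a := mem_singleton_iff.1 (interior_subset hx)
  obtain ⟨N, hN, hNx⟩ := mem_nhds_subtype F x {x} |>.1 (mem_interior_iff_mem_nhds.1 hx)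
  obtain ⟨l, u, hlu, hsub⟩ := mem_nhds_iff_exists_Ioo_subset.1 hN
  refine ⟨x, x.2, l, u, hlu, fun y hy => ?_⟩
  exact congrArg Subtype.val (hNx (a := ⟨y, hy.2⟩) (hsub hy.1))

theorem mem_closure_graphOn_iff {f : ℝ → ℝ} {P : Set ℝ} {a y : ℝ} :
    (a, y) ∈ closure (graphOn f P) ↔ y ∈ clusterVals f P a := by
  rw [clusterVals, mem_ofPred_eq, mapClusterPt_iff_frequently, mem_closure_iff_nhds]
  simp only [frequently_nhdsWithin_iff]
  constructor
  · intro h s hs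
    rw [frequently_iff]
    intro N hN
    obtain ⟨_, hp, x, hx, rfl⟩ := h _ (prod_mem_nhds hN hs)
    exact ⟨x, hp.1, hp.2, hx⟩
  · intro h t ht
    obtain ⟨N, hN, s, hs, hNs⟩ := mem_nhds_prod_iff.1 ht
    obtain ⟨x, hxN, hxs, hxP⟩ := frequently_iff.1 (h s hs) hN
    exact ⟨(x, f x), hNs ⟨hxN, hxs⟩, x, hxP, rfl⟩

theorem snd_mem_of_mem_closure_graphOn {f : ℝ → ℝ} {P N M : Set ℝ} (hN : IsOpen N)
    (hM : IsClosed M) (h : ∀ x ∈ P, x ∈ N → f x ∈ M) {p : ℝ × ℝ}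
    (hp : p ∈ closure (graphOn f P)) (hpN : p.1 ∈ N) : p.2 ∈ M := by
  by_contra hpM
  obtain ⟨_, hq, x, hx, rfl⟩ := mem_closure_iff.1 hp (N ×ˢ Mᶜ) (hN.prod hM.isOpen_compl)
    ⟨hpN, hpM⟩
  exact hq.2 (h x hx hq.1)

/-- A set squeezed between a graph over an interval minus a countable set and its closure is
connected if the left and right cluster values at the exceptional points agree. -/
theorem isPreconnected_of_graphOn_subset {K : Set (ℝ × ℝ)} {I Q : Set ℝ} {f : ℝ → ℝ}
    (hI : I.OrdConnected) (hQ : Q.Countable) (hf : ContinuousOn f (I \ Q))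
    (hGK : graphOn f (I \ Q) ⊆ K) (hKG : K ⊆ closure (graphOn f (I \ Q)))
    (hKI : ∀ p ∈ K, p.1 ∈ I) (hne : ∀ x ∈ I, ∃ y, (x, y) ∈ K)
    (hl : ∀ a ∈ Q, clusterVals f (I \ Q) a = clusterVals f ((I \ Q) ∩ Iic a) a)
    (hr : ∀ a ∈ Q, clusterVals f (I \ Q) a = clusterVals f ((I \ Q) ∩ Ici a) a) :
    IsPreconnected K := by
  rw [isPreconnected_iff_subset_of_disjoint]
  intro U V hU hV hKUV hUV
  have hdisj : ∀ p ∈ K, p ∈ U → p ∈ V → False := fun p hp h1 h2 => by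
    have : p ∈ K ∩ (U ∩ V) := ⟨hp, h1, h2⟩
    rw [hUV] at this
    exact this
  let A : Set (ℝ × ℝ) → Set ℝ := fun O => interior {x | ∀ y, (x, y) ∈ K → (x, y) ∈ O}
  have hAo : ∀ O, IsOpen (A O) := fun O => isOpen_interior
  have hAmem : ∀ {O x y}, x ∈ A O → (x, y) ∈ K → (x, y) ∈ O := fun hx h => interior_subset hx _ h
  have hAdisj : ∀ x ∈ I, x ∈ A U → x ∈ A V → False := fun x hx h1 h2 => by
    obtain ⟨y, hy⟩ := hne x hx
    exact hdisj _ hy (hAmem h1 hy) (hAmem h2 hy)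
  have hpre : ∀ J ⊆ I, J.OrdConnected → J ⊆ A U ∪ A V → J ⊆ A U ∨ J ⊆ A V := by
    intro J hJI hJ hJA
    refine isPreconnected_iff_subset_of_disjoint.1 hJ.isPreconnected _ _ (hAo U) (hAo V) hJA ?_
    exact eq_empty_of_forall_notMem fun x hx => hAdisj x (hJI hx.1) hx.2.1 hx.2.2
  have hregular : ∀ O, IsOpen O → ∀ x ∈ I \ Q, (x, f x) ∈ O → x ∈ A O := by
    intro O hO x hx hxO
    obtain ⟨N, hN, s, hs, hNs⟩ := mem_nhds_prod_iff.1 (hO.mem_nhds hxO)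
    obtain ⟨M, hM, hMc, hMs⟩ := exists_mem_nhds_isClosed_subset hs
    obtain ⟨N', hN'o, hxN', hN'⟩ := mem_nhdsWithin.1 (hf x hx hM)
    refine mem_interior_iff_mem_nhds.2 (mem_of_superset (inter_mem hN (hN'o.mem_nhds hxN')) ?_)
    rintro z ⟨hzN, hzN'⟩ y hzy
    exact hNs ⟨hzN, hMs (snd_mem_of_mem_closure_graphOn hN'o hMc
      (fun w hw hwN => hN' ⟨hwN, hw⟩) (hKG hzy) hzN')⟩
  have hcover : I ⊆ A U ∪ A V := by
    by_contra hnot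
    obtain ⟨a, ⟨haI, haA⟩, l, u, halu, hiso⟩ := exists_isolated_of_isLocallyClosed
      (F := I \ (A U ∪ A V))
      ((isLocallyClosed_of_ordConnected hI).inter
        ((hAo U).union (hAo V)).isClosed_compl.isLocallyClosed)
      (hQ.mono fun x hx => by
        by_contra hxQ
        rcases hKUV (hGK ⟨x, ⟨hx.1, hxQ⟩, rfl⟩) with h | h
        · exact hx.2 (Or.inl (hregular U hU x ⟨hx.1, hxQ⟩ h))
        · exact hx.2 (Or.inr (hregular V hV x ⟨hx.1, hxQ⟩ h)))
      (not_subset.1 hnot)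
    have haQ : a ∈ Q := by
      by_contra haQ
      rcases hKUV (hGK ⟨a, ⟨haI, haQ⟩, rfl⟩) with h | h
      · exact haA (Or.inl (hregular U hU a ⟨haI, haQ⟩ h))
      · exact haA (Or.inr (hregular V hV a ⟨haI, haQ⟩ h))
    have hnear : ∀ x ∈ I, x ∈ Ioo l u → x ≠ a → x ∈ A U ∪ A V := fun x hx hxlu hxa => by
      by_contra hxA
      exact hxa (hiso ⟨hxlu, hx, hxA⟩)
    have hlimit : ∀ (C : Set ℝ) (O O' : Set (ℝ × ℝ)), IsOpen O' → K ⊆ O ∪ O' →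
        (∀ p ∈ K, p ∈ O → p ∈ O' → False) →
        clusterVals f (I \ Q) a = clusterVals f ((I \ Q) ∩ C) a →
        (∀ x ∈ I, x ∈ Ioo l u → x ≠ a → x ∈ C → x ∈ A O) → ∀ y, (a, y) ∈ K → (a, y) ∈ O := by
      intro C O O' hO' hKO hOO' hC hCA y hy
      refine (hKO hy).resolve_right fun hyO' => ?_
      have hcl : (a, y) ∈ closure (graphOn f ((I \ Q) ∩ C)) :=
        mem_closure_graphOn_iff.2 (hC ▸ mem_closure_graphOn_iff.1 (hKG hy))
      obtain ⟨_, ⟨hxO', hxlu, -⟩, x, ⟨hx, hxC⟩, rfl⟩ := mem_closure_iff.1 hcl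
        (O' ∩ Ioo l u ×ˢ univ) (hO'.inter (isOpen_Ioo.prod isOpen_univ)) ⟨hyO', halu, trivial⟩
      have hxK := hGK ⟨x, hx, rfl⟩
      have hxa : x ≠ a := fun h => hx.2 (h ▸ haQ)
      exact hOO' _ hxK (hAmem (hCA x hx.1 hxlu hxa hxC) hxK) hxO'
    have hdisj' : ∀ p ∈ K, p ∈ V → p ∈ U → False := fun p hp h1 h2 => hdisj p hp h2 h1
    have hKVU : K ⊆ V ∪ U := union_comm U V ▸ hKUV
    have hleft : I ∩ Ioo l a ⊆ A U ∨ I ∩ Ioo l a ⊆ A V :=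
      hpre _ inter_subset_left (hI.inter ordConnected_Ioo) fun x hx =>
        hnear x hx.1 ⟨hx.2.1, hx.2.2.trans halu.2⟩ hx.2.2.ne
    have hright : I ∩ Ioo a u ⊆ A U ∨ I ∩ Ioo a u ⊆ A V :=
      hpre _ inter_subset_left (hI.inter ordConnected_Ioo) fun x hx =>
        hnear x hx.1 ⟨halu.1.trans hx.2.1, hx.2.2⟩ hx.2.1.ne'
    have hleft' : ∀ O, I ∩ Ioo l a ⊆ A O →
        ∀ x ∈ I, x ∈ Ioo l u → x ≠ a → x ∈ Iic a → x ∈ A O :=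
      fun O hO x hx hxlu hxa hxC => hO ⟨hx, hxlu.1, lt_of_le_of_ne hxC hxa⟩
    have hright' : ∀ O, I ∩ Ioo a u ⊆ A O →
        ∀ x ∈ I, x ∈ Ioo l u → x ≠ a → x ∈ Ici a → x ∈ A O :=
      fun O hO x hx hxlu hxa hxC => hO ⟨hx, lt_of_le_of_ne hxC hxa.symm, hxlu.2⟩
    have hfinish : ∀ O, (∀ y, (a, y) ∈ K → (a, y) ∈ O) → I ∩ Ioo l a ⊆ A O →
        I ∩ Ioo a u ⊆ A O → a ∈ A O := by
      intro O hO h1 h2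
      refine mem_interior_iff_mem_nhds.2 (mem_of_superset (Ioo_mem_nhds halu.1 halu.2) ?_)
      intro x hx y hxy
      rcases lt_trichotomy x a with h | rfl | h
      · exact hAmem (h1 ⟨hKI _ hxy, hx.1, h⟩) hxy
      · exact hO y hxy
      · exact hAmem (h2 ⟨hKI _ hxy, h, hx.2⟩) hxy
    obtain ⟨y, hy⟩ := hne a haI
    rcases hleft with h1 | h1 <;> rcases hright with h2 | h2
    · exact haA (Or.inl (hfinish U
        (hlimit _ U V hV hKUV hdisj (hl a haQ) (hleft' U h1)) h1 h2))
    · exact hdisj _ hy (hlimit _ U V hV hKUV hdisj (hl a haQ) (hleft' U h1) y hy)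
        (hlimit _ V U hU hKVU hdisj' (hr a haQ) (hright' V h2) y hy)
    · exact hdisj _ hy (hlimit _ U V hV hKUV hdisj (hr a haQ) (hright' U h2) y hy)
        (hlimit _ V U hU hKVU hdisj' (hl a haQ) (hleft' V h1) y hy)
    · exact haA (Or.inr (hfinish V
        (hlimit _ V U hU hKVU hdisj' (hl a haQ) (hleft' V h1)) h1 h2))
  rcases hpre I Subset.rfl hI hcover with h | h
  · exact Or.inl fun p hp => hAmem (h (hKI p hp)) hp
  · exact Or.inr fun p hp => hAmem (h (hKI p hp)) hp

theorem not_dimLE_zero_of_preconnectedSpace (X : Type*) [TopologicalSpace X] [T1Space X]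
    [PreconnectedSpace X] [Nontrivial X] : ¬ DimLE X 0 := by
  intro h
  obtain ⟨p, q, hpq⟩ := exists_pair_ne X
  obtain ⟨V, hVo, hVU, hcov, hV⟩ := h 2 ![{p}ᶜ, {q}ᶜ]
    (by
      intro i
      fin_cases i
      exacts [isOpen_compl_singleton, isOpen_compl_singleton])
    (by
      refine eq_univ_of_forall fun x => mem_iUnion.2 ?_
      by_cases hx : x = p
      · exact ⟨1, fun hxq => hpq (hx.symm.trans hxq)⟩
      · exact ⟨0, hx⟩)
  have hp : p ∉ V 0 := fun h => hVU 0 h rfl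
  have hq : q ∉ V 1 := fun h => hVU 1 h rfl
  have hor : ∀ x, x ∈ V 0 ∨ x ∈ V 1 := fun x => by
    have hx : x ∈ ⋃ i, V i := hcov ▸ mem_univ x
    simpa [Fin.exists_fin_two] using hx
  have hnot : ∀ x, x ∈ V 0 → x ∈ V 1 → False := fun x h0 h1 =>
    zero_ne_one ((ncard_le_one (toFinite _)).1 (hV x) (0 : Fin 2) h0 1 h1)
  have hcompl : V 0 = (V 1)ᶜ := by
    ext x
    exact ⟨fun h0 h1 => hnot x h0 h1, fun h1 => (hor x).resolve_right h1⟩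
  have hclopen : IsClopen (V 0) := ⟨hcompl ▸ (hVo 1).isClosed_compl, hVo 0⟩
  rcases isClopen_iff.1 hclopen with h0 | h0
  · exact (h0 ▸ (hor q).resolve_right hq : q ∈ (∅ : Set X))
  · exact hp (h0 ▸ mem_univ p)

theorem IsHypergraphWith.not_dimLE_zero {H K : Set (ℝ × ℝ)} {I Q : Set ℝ} {f : ℝ → ℝ}
    (hH : IsHypergraphWith H I Q f) (hHK : H ⊆ K) (hK : K ⊆ closure (graphOn f (I \ Q))) :
    ¬ DimLE K 0 := by
  obtain ⟨hI, ⟨u, hu, v, hv, huv⟩, -, hQ, hf, hGH, -, hsec⟩ := hH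
  have hne : ∀ x ∈ I, ∃ y, (x, y) ∈ K := by
    intro x hx
    by_cases hxQ : x ∈ Q
    · obtain ⟨⟨-, -, -, y, hy, -⟩, -, hcl, -⟩ := hsec x hxQ
      obtain ⟨z, hz⟩ := closure_nonempty_iff.1 ⟨y, hcl y hy⟩
      exact ⟨z, hHK hz⟩
    · exact ⟨f x, hHK (hGH ⟨x, ⟨hx, hxQ⟩, rfl⟩)⟩
  have hGK : graphOn f (I \ Q) ⊆ K ∩ {p | p.1 ∈ I} := by
    rintro _ ⟨x, hx, rfl⟩
    exact ⟨hHK (hGH ⟨x, hx, rfl⟩), hx.1⟩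
  have hpre : IsPreconnected (K ∩ {p | p.1 ∈ I}) :=
    isPreconnected_of_graphOn_subset hI hQ hf hGK (inter_subset_left.trans hK)
      (fun p hp => hp.2) (fun x hx => (hne x hx).imp fun y hy => ⟨hy, hx⟩)
      (fun a ha => (hsec a ha).1.1) (fun a ha => (hsec a ha).1.2.1)
  have hpreK : IsPreconnected K :=
    hpre.subset_closure inter_subset_left (hK.trans (closure_mono hGK))
  have := isPreconnected_iff_preconnectedSpace.1 hpreK
  obtain ⟨y, hy⟩ := hne u hu
  obtain ⟨z, hz⟩ := hne v hv
  have : Nontrivial K := ⟨⟨_, hy⟩, ⟨_, hz⟩, fun h => huv.ne (congrArg (fun p : K => p.1.1) h)⟩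
  exact not_dimLE_zero_of_preconnectedSpace K

theorem dimLE_one_of_subset_closure_graphOn {K : Set (ℝ × ℝ)} {I Q : Set ℝ} {f : ℝ → ℝ}
    (hI : I.OrdConnected) (hQ : Q.Countable) (hf : ContinuousOn f (I \ Q))
    (hK : K ⊆ closure (graphOn f (I \ Q))) : DimLE K 1 := by
  refine dimLE_one_of_countable_sections (f := f)
    (hQ.union (finite_closure_diff_of_ordConnected hI).countable) ?_
  rintro ⟨x, y⟩ hp hx
  have hxI : x ∈ closure I := by
    by_contra hxI
    exact snd_mem_of_mem_closure_graphOn (M := ∅) isClosed_closure.isOpen_compl isClosed_empty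
      (fun z hz hz' => hz' (subset_closure hz.1)) (hK hp) hxI
  have hxP : x ∈ I \ Q :=
    ⟨by_contra fun h => hx (Or.inr ⟨hxI, h⟩), fun h => hx (Or.inl h)⟩
  by_contra hy
  obtain ⟨M, hM, hMc, hMs⟩ := exists_mem_nhds_isClosed_subset
    (isOpen_compl_singleton.mem_nhds (Ne.symm hy) : {y}ᶜ ∈ 𝓝 (f x))
  obtain ⟨N, hN, hxN, hNM⟩ := mem_nhdsWithin.1 (hf x hxP hM)
  exact hMs (snd_mem_of_mem_closure_graphOn hN hMc (fun w hw hwN => hNM ⟨hwN, hw⟩) (hK hp) hxN) rfl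

/-- If `H` is a hypergraph with graph part `G`, then `dim H = dim cl(G) = 1` (where the
closure is taken in `ℝ²` and `dim` is the covering dimension). -/
theorem hypergraph_dim_eq_one (H : Set (ℝ × ℝ)) (I Q : Set ℝ) (f : ℝ → ℝ)
    (hH : IsHypergraphWith H I Q f) :
    DimLE (↥H) 1 ∧ ¬ DimLE (↥H) 0 ∧
    DimLE (↥(closure (Set.graphOn f (I \ Q)))) 1 ∧
    ¬ DimLE (↥(closure (Set.graphOn f (I \ Q)))) 0 := by
  obtain ⟨hI, -, -, hQ, hf, -, hHG, -⟩ := id hH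
  exact ⟨dimLE_one_of_subset_closure_graphOn hI hQ hf hHG, hH.not_dimLE_zero Subset.rfl hHG,
    dimLE_one_of_subset_closure_graphOn hI hQ hf Subset.rfl, hH.not_dimLE_zero hHG Subset.rfl⟩
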